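/- arXiv:2503.00273 — 2 statements merged into one kernel-verified Lean document; each statement's English description precedes it below -/
import Mathlib

section
/- For every ε ∈ (0,1) and every γ > 0 there exists a constant C > 0 such that for all integers n ≥ 2, all Δ ∈ (0, 1-ε], and all horizons t ∈ ℕ with t ≥ n^γ/Δ², the optimal success probability satisfies p*_t ≤ C·t·Δ²/n. -/
open scoped BigOperators

noncomputable section

/-- Probability that pulling arm `a` yields reward `r : Bool` (with `true` = reward 1),
when the best arm is `astar`: `Bernoulli ((1+Δ)/2)` if `a = astar`, else `Bernoulli ((1-Δ)/2)`. -/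
def rewP (n : ℕ) (Δ : ℝ) (astar a : Fin n) (r : Bool) : ℝ :=
  if r then (if a = astar then (1 + Δ) / 2 else (1 - Δ) / 2)
  else 1 - (if a = astar then (1 + Δ) / 2 else (1 - Δ) / 2)

/-- An interactive algorithm: for every history (recorded with the most recent pull first),
a probability distribution over the `n` arms used to draw the next pull. -/
def IsAlg (n : ℕ) (alg : List (Fin n × Bool) → Fin n → ℝ) : Prop :=
  ∀ h : List (Fin n × Bool), (∀ a, 0 ≤ alg h a) ∧ (∑ a : Fin n, alg h a) = 1

/-- Probability, conditionally on the best arm `astar`, of observing a given history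
(recorded with the most recent pull first) when running the algorithm `alg`. -/
def histP (n : ℕ) (alg : List (Fin n × Bool) → Fin n → ℝ) (Δ : ℝ) (astar : Fin n) :
    List (Fin n × Bool) → ℝ
  | [] => 1
  | (a, r) :: prev => histP n alg Δ astar prev * alg prev a * rewP n Δ astar a r

/-- The reversed history (most recent pull first) associated with a tuple of `t` pulls. -/
def hist {n t : ℕ} (h : Fin t → Fin n × Bool) : List (Fin n × Bool) :=
  (List.ofFn h).reverse

/-- Success probability `P(a_{t+1} = a*)` of an interactive algorithm after `t` rounds,
under the uniform prior on the best arm. -/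
def succProb (n t : ℕ) (alg : List (Fin n × Bool) → Fin n → ℝ) (Δ : ℝ) : ℝ :=
  ((n : ℝ))⁻¹ * ∑ astar : Fin n, ∑ h : Fin t → Fin n × Bool,
    histP n alg Δ astar (hist h) * alg (hist h) astar

/-- Mutual information (in nats) `I(a*; H_t)` accumulated by an interactive algorithm. -/
def mutualInfo (n t : ℕ) (alg : List (Fin n × Bool) → Fin n → ℝ) (Δ : ℝ) : ℝ :=
  ∑ astar : Fin n, ∑ h : Fin t → Fin n × Bool,
    ((n : ℝ))⁻¹ * histP n alg Δ astar (hist h) *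
      Real.log (histP n alg Δ astar (hist h) /
        (((n : ℝ))⁻¹ * ∑ b : Fin n, histP n alg Δ b (hist h)))

/-- Optimal success probability `p*_t`. -/
def pStar (n t : ℕ) (Δ : ℝ) : ℝ :=
  sSup {x : ℝ | ∃ alg, IsAlg n alg ∧ x = succProb n t alg Δ}

/-- Optimal mutual information `I*_t`. -/
def IStar (n t : ℕ) (Δ : ℝ) : ℝ :=
  sSup {x : ℝ | ∃ alg, IsAlg n alg ∧ x = mutualInfo n t alg Δ}

/-- Reward probabilities under the null model, in which no arm is the best one. -/
def nullRewP (Δ : ℝ) (r : Bool) : ℝ :=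
  if r then (1 - Δ) / 2 else (1 + Δ) / 2

/-- Probability of a history under the null model. -/
def nullP (n : ℕ) (alg : List (Fin n × Bool) → Fin n → ℝ) (Δ : ℝ) :
    List (Fin n × Bool) → ℝ
  | [] => 1
  | (a, r) :: prev => nullP n alg Δ prev * alg prev a * nullRewP Δ r

/-- Log-likelihood ratio of a single pull, between best arm `astar` and the null model. -/
def llrStep (n : ℕ) (Δ : ℝ) (astar a : Fin n) (r : Bool) : ℝ :=
  if a = astar then
    (if r then Real.log ((1 + Δ) / (1 - Δ)) else -Real.log ((1 + Δ) / (1 - Δ))) else 0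

/-- Log-likelihood ratio of a history, between best arm `astar` and the null model. -/
def llr (n : ℕ) (Δ : ℝ) (astar : Fin n) : List (Fin n × Bool) → ℝ
  | [] => 0
  | (a, r) :: prev => llr n Δ astar prev + llrStep n Δ astar a r

theorem rewP_eq_nullRewP_mul_exp {n : ℕ} {Δ : ℝ} (h0 : 0 < Δ) (h1 : Δ < 1)
    (astar a : Fin n) (r : Bool) :
    rewP n Δ astar a r = nullRewP Δ r * Real.exp (llrStep n Δ astar a r) := by
  have hm : 0 < 1 - Δ := by linarith
  have hp : 0 < 1 + Δ := by linarith
  have hd : 0 < (1 + Δ) / (1 - Δ) := div_pos hp hm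
  by_cases ha : a = astar <;> cases r <;>
    simp [rewP, nullRewP, llrStep, ha, Real.exp_neg, Real.exp_log hd]
  · field_simp
    ring
  · field_simp
  · ring

theorem histP_eq_nullP_mul_exp {n : ℕ} {Δ : ℝ} (h0 : 0 < Δ) (h1 : Δ < 1)
    (alg : List (Fin n × Bool) → Fin n → ℝ) (astar : Fin n) (h : List (Fin n × Bool)) :
    histP n alg Δ astar h = nullP n alg Δ h * Real.exp (llr n Δ astar h) := by
  induction h with
  | nil => simp [histP, nullP, llr]
  | cons x prev ih =>
    obtain ⟨a, r⟩ := x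
    simp only [histP, nullP, llr, ih, rewP_eq_nullRewP_mul_exp h0 h1, Real.exp_add]
    ring

theorem nullP_nonneg {n : ℕ} {Δ : ℝ} (h0 : 0 < Δ) (h1 : Δ < 1)
    {alg : List (Fin n × Bool) → Fin n → ℝ} (halg : IsAlg n alg) (h : List (Fin n × Bool)) :
    0 ≤ nullP n alg Δ h := by
  induction h with
  | nil => simp [nullP]
  | cons x prev ih =>
    obtain ⟨a, r⟩ := x
    have hr : 0 ≤ nullRewP Δ r := by
      unfold nullRewP
      split_ifs <;> linarith
    exact mul_nonneg (mul_nonneg ih ((halg prev).1 a)) hr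

theorem sum_hist_succ {n t : ℕ} (F : List (Fin n × Bool) → ℝ) :
    ∑ h : Fin (t + 1) → Fin n × Bool, F (hist h) =
      ∑ h : Fin t → Fin n × Bool, ∑ a : Fin n, (F ((a, true) :: hist h) +
        F ((a, false) :: hist h)) := by
  rw [← (Fin.snocEquiv fun _ => Fin n × Bool).sum_comp, Fintype.sum_prod_type_right]
  refine Finset.sum_congr rfl fun h _ => ?_
  rw [Fintype.sum_prod_type]
  refine Finset.sum_congr rfl fun a _ => ?_
  rw [Fintype.sum_bool]
  simp only [hist, Fin.snocEquiv, Equiv.coe_fn_mk, List.ofFn_succ', Fin.snoc_castSucc,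
    Fin.snoc_last, List.concat_eq_append, List.reverse_append, List.reverse_singleton,
    List.singleton_append]

theorem sum_histP {n : ℕ} {Δ : ℝ} {alg : List (Fin n × Bool) → Fin n → ℝ}
    (halg : IsAlg n alg) (astar : Fin n) (t : ℕ) :
    ∑ h : Fin t → Fin n × Bool, histP n alg Δ astar (hist h) = 1 := by
  induction t with
  | zero => simp [hist, histP]
  | succ t ih =>
    rw [sum_hist_succ, ← ih]
    refine Finset.sum_congr rfl fun h _ => ?_
    calc _ = ∑ a, histP n alg Δ astar (hist h) * alg (hist h) a :=
          Finset.sum_congr rfl fun a _ => by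
            simp only [histP, rewP, if_true, Bool.false_eq_true, if_false]
            ring
      _ = _ := by rw [← Finset.mul_sum, (halg _).2, mul_one]

theorem sum_nullP {n : ℕ} {Δ : ℝ} {alg : List (Fin n × Bool) → Fin n → ℝ}
    (halg : IsAlg n alg) (t : ℕ) :
    ∑ h : Fin t → Fin n × Bool, nullP n alg Δ (hist h) = 1 := by
  induction t with
  | zero => simp [hist, nullP]
  | succ t ih =>
    rw [sum_hist_succ, ← ih]
    refine Finset.sum_congr rfl fun h _ => ?_
    calc _ = ∑ a, nullP n alg Δ (hist h) * alg (hist h) a :=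
          Finset.sum_congr rfl fun a _ => by simp [nullP, nullRewP]; ring
      _ = _ := by rw [← Finset.mul_sum, (halg _).2, mul_one]

theorem sum_llr_cons {n : ℕ} (Δ : ℝ) (a : Fin n) (r : Bool) (h : List (Fin n × Bool)) :
    ∑ b, llr n Δ b ((a, r) :: h) = (∑ b, llr n Δ b h) +
      if r then Real.log ((1 + Δ) / (1 - Δ)) else -Real.log ((1 + Δ) / (1 - Δ)) := by
  simp [llr, llrStep, Finset.sum_add_distrib]

/-- The expected total log-likelihood ratio under the null model, that is, minus the sum over
the arms of the relative entropies of the null model with respect to the true ones. -/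
theorem sum_nullP_mul_sum_llr {n : ℕ} {Δ : ℝ} {alg : List (Fin n × Bool) → Fin n → ℝ}
    (halg : IsAlg n alg) (t : ℕ) :
    ∑ h : Fin t → Fin n × Bool, nullP n alg Δ (hist h) * ∑ b, llr n Δ b (hist h) =
      -(t * (Δ * Real.log ((1 + Δ) / (1 - Δ)))) := by
  induction t with
  | zero => simp [hist, llr]
  | succ t ih =>
    rw [sum_hist_succ (fun l => nullP n alg Δ l * ∑ b, llr n Δ b l)]
    calc _ = ∑ h : Fin t → Fin n × Bool, (nullP n alg Δ (hist h) * ∑ b, llr n Δ b (hist h) -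
            nullP n alg Δ (hist h) * (Δ * Real.log ((1 + Δ) / (1 - Δ)))) := by
          refine Finset.sum_congr rfl fun h _ => ?_
          calc _ = ∑ a, (nullP n alg Δ (hist h) * ∑ b, llr n Δ b (hist h) -
                nullP n alg Δ (hist h) * (Δ * Real.log ((1 + Δ) / (1 - Δ)))) *
                  alg (hist h) a :=
                Finset.sum_congr rfl fun a _ => by
                  simp only [sum_llr_cons, nullP, nullRewP, if_true, Bool.false_eq_true, if_false]
                  ring
            _ = _ := by rw [← Finset.mul_sum, (halg _).2, mul_one]
      _ = _ := by
          rw [Finset.sum_sub_distrib, ih, ← Finset.sum_mul, sum_nullP halg]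
          push_cast
          ring

theorem exp_mul_le_two_mul_add {w : ℝ} (hw0 : 0 ≤ w) (hw1 : w ≤ 1) (l : ℝ) :
    Real.exp l * w ≤ 2 * w + 2 * (Real.exp l - 1 - l) := by
  have h1 : l + 1 ≤ Real.exp l := Real.add_one_le_exp l
  have h2 : 2 * l ≤ Real.exp l := by
    have h := Real.add_one_le_exp (l - 1)
    rw [Real.exp_sub, sub_add_cancel, le_div_iff₀ (Real.exp_pos 1)] at h
    rcases le_total l 0 with hl | hl
    · linarith [Real.exp_pos l]
    · nlinarith [Real.exp_one_gt_d9]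
  rcases le_total (Real.exp l) 2 with h | h
  · nlinarith
  · nlinarith

theorem succProb_le {n : ℕ} {Δ : ℝ} (h0 : 0 < Δ) (h1 : Δ < 1)
    {alg : List (Fin n × Bool) → Fin n → ℝ} (halg : IsAlg n alg) (t : ℕ) :
    succProb n t alg Δ ≤ (n : ℝ)⁻¹ * (2 + 2 * (t * (Δ * Real.log ((1 + Δ) / (1 - Δ))))) := by
  unfold succProb
  refine mul_le_mul_of_nonneg_left ?_ (by positivity)
  have hpt (l : List (Fin n × Bool)) (a : Fin n) : histP n alg Δ a l * alg l a ≤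
      2 * (nullP n alg Δ l * alg l a) +
        2 * (histP n alg Δ a l - nullP n alg Δ l - nullP n alg Δ l * llr n Δ a l) := by
    have hle : alg l a ≤ 1 := by
      rw [← (halg l).2]
      exact Finset.single_le_sum (fun b _ => (halg l).1 b) (Finset.mem_univ a)
    have h := mul_le_mul_of_nonneg_left
      (exp_mul_le_two_mul_add ((halg l).1 a) hle (llr n Δ a l)) (nullP_nonneg h0 h1 halg l)
    rw [histP_eq_nullP_mul_exp h0 h1]
    linarith
  have hguess : ∑ a, ∑ h : Fin t → Fin n × Bool, nullP n alg Δ (hist h) * alg (hist h) a = 1 := by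
    rw [Finset.sum_comm]
    simp_rw [← Finset.mul_sum, (halg _).2, mul_one]
    exact sum_nullP halg t
  have hllr : ∑ a, ∑ h : Fin t → Fin n × Bool, nullP n alg Δ (hist h) * llr n Δ a (hist h) =
      -(t * (Δ * Real.log ((1 + Δ) / (1 - Δ)))) := by
    rw [Finset.sum_comm]
    simp_rw [← Finset.mul_sum]
    exact sum_nullP_mul_sum_llr halg t
  refine (Finset.sum_le_sum fun a _ => Finset.sum_le_sum fun h _ => hpt (hist h) a).trans ?_
  simp_rw [Finset.sum_add_distrib, ← Finset.mul_sum, Finset.sum_sub_distrib, hguess, hllr,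
    sum_histP halg, sum_nullP halg]
  simp

/-- Converse for the success probability at large `t`: for every `ε ∈ (0,1)` and `γ > 0` there is
`C > 0` such that for all `n ≥ 2`, `Δ ∈ (0, 1-ε]` and horizons `t ≥ n^γ/Δ²`,
`p*_t ≤ C t Δ² / n`. -/
theorem bandit_success_converse_large_t :
    ∀ ε : ℝ, ε ∈ Set.Ioo (0 : ℝ) 1 → ∀ γ : ℝ, 0 < γ → ∃ C : ℝ, 0 < C ∧
      ∀ n : ℕ, 2 ≤ n → ∀ Δ : ℝ, Δ ∈ Set.Ioc (0 : ℝ) (1 - ε) →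
        ∀ t : ℕ, (n : ℝ) ^ γ / Δ ^ 2 ≤ (t : ℝ) →
          pStar n t Δ ≤ C * t * Δ ^ 2 / n := by
  intro ε hε γ hγ
  obtain ⟨hε, -⟩ := hε
  refine ⟨2 + 4 / ε, by positivity, ?_⟩
  rintro n hn Δ ⟨h0, hΔ⟩ t ht
  have h1 : Δ < 1 := by linarith
  have hT : 1 ≤ t * Δ ^ 2 := by
    rw [div_le_iff₀ (by positivity)] at ht
    exact (Real.one_le_rpow (by exact_mod_cast (by omega : 1 ≤ n)) hγ.le).trans ht
  have hlog : Real.log ((1 + Δ) / (1 - Δ)) ≤ 2 * Δ / ε := by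
    have hm : 0 < 1 - Δ := by linarith
    have hd : 0 < (1 + Δ) / (1 - Δ) := div_pos (by linarith) hm
    calc _ ≤ (1 + Δ) / (1 - Δ) - 1 := Real.log_le_sub_one_of_pos hd
      _ = 2 * Δ / (1 - Δ) := by field_simp; ring
      _ ≤ _ := by gcongr; linarith
  refine Real.sSup_le ?_ (by positivity)
  rintro x ⟨alg, halg, rfl⟩
  calc succProb n t alg Δ
      ≤ (n : ℝ)⁻¹ * (2 + 2 * (t * (Δ * Real.log ((1 + Δ) / (1 - Δ))))) := succProb_le h0 h1 halg t
    _ ≤ (n : ℝ)⁻¹ * (2 * (t * Δ ^ 2) + 2 * (t * (Δ * (2 * Δ / ε)))) := by gcongr; linarith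
    _ = (2 + 4 / ε) * t * Δ ^ 2 / n := by ring
end
end

section
/- For every ε ∈ (0,1) there exists a constant c > 0 such that for all integers n ≥ 2, all Δ ∈ (0, 1-ε], and all horizons t ∈ ℕ with t ≤ 1/Δ² and t ≤ n/Δ², the optimal mutual information satisfies I*_t ≥ c·t·Δ²/n. -/
open scoped BigOperators

noncomputable section

lemma rewP_nonneg {n : ℕ} {Δ : ℝ} (h0 : 0 ≤ Δ) (h1 : Δ ≤ 1) (b a : Fin n) (r : Bool) :
    0 ≤ rewP n Δ b a r := by
  unfold rewP
  split_ifs <;> linarith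

lemma rewP_le_one {n : ℕ} {Δ : ℝ} (h0 : 0 ≤ Δ) (h1 : Δ ≤ 1) (b a : Fin n) (r : Bool) :
    rewP n Δ b a r ≤ 1 := by
  unfold rewP
  split_ifs <;> linarith

lemma IsAlg.le_one {n : ℕ} {alg : List (Fin n × Bool) → Fin n → ℝ} (halg : IsAlg n alg)
    (l : List (Fin n × Bool)) (a : Fin n) : alg l a ≤ 1 := by
  rw [← (halg l).2]
  exact Finset.single_le_sum (fun b _ => (halg l).1 b) (Finset.mem_univ a)

lemma histP_mem_Icc {n : ℕ} {alg : List (Fin n × Bool) → Fin n → ℝ} (halg : IsAlg n alg)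
    {Δ : ℝ} (h0 : 0 ≤ Δ) (h1 : Δ ≤ 1) (b : Fin n) (l : List (Fin n × Bool)) :
    histP n alg Δ b l ∈ Set.Icc (0 : ℝ) 1 := by
  induction l with
  | nil => simp [histP]
  | cons x l ih =>
    obtain ⟨a, r⟩ := x
    have ha := (halg l).1 a
    have hr := rewP_nonneg h0 h1 b a r
    exact ⟨mul_nonneg (mul_nonneg ih.1 ha) hr,
      mul_le_one₀ (mul_le_one₀ ih.2 ha (halg.le_one l a)) hr (rewP_le_one h0 h1 b a r)⟩

lemma mutualInfo_le {n : ℕ} (t : ℕ) (hn : 1 ≤ n) {alg : List (Fin n × Bool) → Fin n → ℝ}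
    (halg : IsAlg n alg) {Δ : ℝ} (h0 : 0 ≤ Δ) (h1 : Δ ≤ 1) :
    mutualInfo n t alg Δ ≤
      ∑ _astar : Fin n, ∑ _h : Fin t → Fin n × Bool, (n : ℝ)⁻¹ * Real.log n := by
  unfold mutualInfo
  refine Finset.sum_le_sum fun a _ => Finset.sum_le_sum fun h _ => ?_
  have hn' : (1 : ℝ) ≤ n := by exact_mod_cast hn
  have hp b := histP_mem_Icc halg h0 h1 b (hist h)
  have hsum := Finset.single_le_sum (fun b _ => (hp b).1) (Finset.mem_univ a)
  rw [mul_assoc]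
  refine mul_le_mul_of_nonneg_left ?_ (by positivity)
  rcases (hp a).1.eq_or_lt with hz | hpos
  · rw [← hz]
    simpa using Real.log_nonneg hn'
  have hm : 0 < (n : ℝ)⁻¹ * ∑ b : Fin n, histP n alg Δ b (hist h) :=
    mul_pos (by positivity) (hpos.trans_le hsum)
  have hlog : Real.log (histP n alg Δ a (hist h) /
      ((n : ℝ)⁻¹ * ∑ b : Fin n, histP n alg Δ b (hist h))) ≤ Real.log n := by
    refine Real.log_le_log (div_pos hpos hm) ?_
    rw [div_le_iff₀ hm, mul_inv_cancel_left₀ (by positivity)]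
    exact hsum
  calc _ ≤ histP n alg Δ a (hist h) * Real.log n := mul_le_mul_of_nonneg_left hlog hpos.le
    _ ≤ 1 * Real.log n := mul_le_mul_of_nonneg_right (hp a).2 (Real.log_nonneg hn')
    _ = _ := one_mul _

lemma mutualInfo_le_IStar {n : ℕ} (t : ℕ) (hn : 1 ≤ n)
    {alg : List (Fin n × Bool) → Fin n → ℝ} (halg : IsAlg n alg)
    {Δ : ℝ} (h0 : 0 ≤ Δ) (h1 : Δ ≤ 1) :
    mutualInfo n t alg Δ ≤ IStar n t Δ := by
  refine le_csSup ⟨∑ _astar : Fin n, ∑ _h : Fin t → Fin n × Bool, (n : ℝ)⁻¹ * Real.log n, ?_⟩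
    ⟨alg, halg, rfl⟩
  rintro _ ⟨alg', halg', rfl⟩
  exact mutualInfo_le t hn halg' h0 h1

/-- Pointwise form of the bound of the Kullback-Leibler divergence by the squared Hellinger
distance. -/
lemma sub_add_sq_sqrt_sub_le_mul_log_div {p m : ℝ} (hp : 0 ≤ p) (hm : 0 ≤ m)
    (hpm : m = 0 → p = 0) :
    p - m + (√p - √m) ^ 2 ≤ p * Real.log (p / m) := by
  rcases hp.eq_or_lt with rfl | hp
  · simp [Real.sq_sqrt hm]
  have hm' : 0 < m := hm.lt_of_ne fun h => hp.ne' (hpm h.symm)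
  have hsp := Real.sqrt_pos.2 hp
  have hsm := Real.sqrt_pos.2 hm'
  have h1 := Real.log_le_sub_one_of_pos (div_pos hsm hsp)
  have h2 : Real.log (p / m) = -2 * Real.log (√m / √p) := by
    rw [Real.log_div hp.ne' hm'.ne', Real.log_div hsm.ne' hsp.ne', Real.log_sqrt hp.le,
      Real.log_sqrt hm]
    ring
  have h3 : p * (√m / √p) = √p * √m := by
    nth_rewrite 1 [← Real.mul_self_sqrt hp.le]
    field_simp
  have h4 := mul_le_mul_of_nonneg_left h1 hp.le
  rw [h2]
  nlinarith [Real.sq_sqrt hp.le, Real.sq_sqrt hm]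

/-- The mutual information dominates the squared Hellinger distance between the laws of the
history under two candidate best arms. -/
lemma hellinger_le_mutualInfo {n : ℕ} (t : ℕ) {alg : List (Fin n × Bool) → Fin n → ℝ}
    (halg : IsAlg n alg) {Δ : ℝ} (h0 : 0 ≤ Δ) (h1 : Δ ≤ 1) {i j : Fin n} (hij : i ≠ j) :
    (2 * n : ℝ)⁻¹ * ∑ h : Fin t → Fin n × Bool,
        (√(histP n alg Δ i (hist h)) - √(histP n alg Δ j (hist h))) ^ 2 ≤
      mutualInfo n t alg Δ := by
  unfold mutualInfo
  rw [Finset.sum_comm, Finset.mul_sum]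
  refine Finset.sum_le_sum fun h _ => ?_
  have hn : (0 : ℝ) < n := by exact_mod_cast i.pos
  have hp b := (histP_mem_Icc halg h0 h1 b (hist h)).1
  set p : Fin n → ℝ := fun b => histP n alg Δ b (hist h)
  set m : ℝ := (n : ℝ)⁻¹ * ∑ b, p b with hm
  have hm0 : 0 ≤ m := mul_nonneg (by positivity) (Finset.sum_nonneg fun b _ => hp b)
  have hmz (a : Fin n) (hz : m = 0) : p a = 0 := by
    have hs : ∑ b, p b = 0 := (mul_eq_zero.1 hz).resolve_left (by positivity)
    exact (Finset.sum_eq_zero_iff_of_nonneg fun b _ => hp b).1 hs a (Finset.mem_univ a)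
  have hcentred : ∑ a, (p a - m) = 0 := by
    rw [Finset.sum_sub_distrib, Finset.sum_const, Finset.card_univ, Fintype.card_fin,
      nsmul_eq_mul, hm, mul_inv_cancel_left₀ hn.ne', sub_self]
  have hpair : (√(p i) - √m) ^ 2 + (√(p j) - √m) ^ 2 ≤ ∑ a, (√(p a) - √m) ^ 2 := by
    rw [← Finset.sum_pair (f := fun a => (√(p a) - √m) ^ 2) hij]
    exact Finset.sum_le_sum_of_subset_of_nonneg (Finset.subset_univ _)
      fun _ _ _ => sq_nonneg _
  have hkl : ∑ a, (p a - m + (√(p a) - √m) ^ 2) ≤ ∑ a, p a * Real.log (p a / m) :=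
    Finset.sum_le_sum fun a _ => sub_add_sq_sqrt_sub_le_mul_log_div (hp a) hm0 (hmz a)
  rw [Finset.sum_add_distrib, hcentred, zero_add] at hkl
  calc (2 * n : ℝ)⁻¹ * (√(p i) - √(p j)) ^ 2
      = (n : ℝ)⁻¹ * ((√(p i) - √(p j)) ^ 2 / 2) := by field_simp
    _ ≤ (n : ℝ)⁻¹ * ∑ a, p a * Real.log (p a / m) := by
        refine mul_le_mul_of_nonneg_left ?_ (by positivity)
        nlinarith [sq_nonneg (√(p i) - √m + (√(p j) - √m))]
    _ = ∑ a, (n : ℝ)⁻¹ * p a * Real.log (p a / m) := by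
        rw [Finset.mul_sum]
        exact Finset.sum_congr rfl fun a _ => (mul_assoc _ _ _).symm

/-- The algorithm that always pulls the arm `i`. -/
def constAlg {n : ℕ} (i : Fin n) : List (Fin n × Bool) → Fin n → ℝ :=
  fun _ a => if a = i then 1 else 0

lemma isAlg_constAlg {n : ℕ} (i : Fin n) : IsAlg n (constAlg i) := fun _ =>
  ⟨fun a => by unfold constAlg; split_ifs <;> norm_num, by simp [constAlg]⟩

/-- Law of a single pull of `constAlg i` when the best arm is `b`. -/
def pullP {n : ℕ} (Δ : ℝ) (i b : Fin n) (x : Fin n × Bool) : ℝ :=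
  (if x.1 = i then 1 else 0) * rewP n Δ b x.1 x.2

lemma pullP_nonneg {n : ℕ} {Δ : ℝ} (h0 : 0 ≤ Δ) (h1 : Δ ≤ 1) (i b : Fin n)
    (x : Fin n × Bool) : 0 ≤ pullP Δ i b x :=
  mul_nonneg (by split_ifs <;> norm_num) (rewP_nonneg h0 h1 _ _ _)

lemma histP_constAlg {n : ℕ} (Δ : ℝ) (i b : Fin n) (l : List (Fin n × Bool)) :
    histP n (constAlg i) Δ b l = (l.map (pullP Δ i b)).prod := by
  induction l with
  | nil => simp [histP]
  | cons x l ih =>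
    obtain ⟨a, r⟩ := x
    simp only [histP, ih, constAlg, pullP, List.map_cons, List.prod_cons]
    ring

lemma histP_constAlg_hist {n t : ℕ} (Δ : ℝ) (i b : Fin n) (h : Fin t → Fin n × Bool) :
    histP n (constAlg i) Δ b (hist h) = ∏ s, pullP Δ i b (h s) := by
  rw [histP_constAlg, hist, List.map_reverse, List.prod_reverse, List.map_ofFn, List.prod_ofFn]
  rfl

lemma sum_pullP {n : ℕ} (Δ : ℝ) (i b : Fin n) : ∑ x, pullP Δ i b x = 1 := by
  rw [Fintype.sum_prod_type, Finset.sum_eq_single i]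
  · simp [pullP, rewP]
  · intro a _ ha
    simp [pullP, ha]
  · simp

lemma sum_sqrt_pullP_mul {n : ℕ} {Δ : ℝ} {i j : Fin n} (hij : i ≠ j) :
    ∑ x, √(pullP Δ i i x * pullP Δ i j x) = √(1 - Δ ^ 2) := by
  have h1 : √((1 + Δ) / 2 * ((1 - Δ) / 2)) = √(1 - Δ ^ 2) / 2 := by
    rw [show (1 + Δ) / 2 * ((1 - Δ) / 2) = (1 - Δ ^ 2) / 2 ^ 2 by ring,
      Real.sqrt_div' _ (by norm_num), Real.sqrt_sq (by norm_num)]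
  have h2 : √((1 - (1 + Δ) / 2) * (1 - (1 - Δ) / 2)) = √(1 - Δ ^ 2) / 2 := by
    rw [← h1]
    congr 1
    ring
  rw [Fintype.sum_prod_type, Finset.sum_eq_single i]
  · simp [pullP, rewP, hij, h1, h2]
  · intro a _ ha
    simp [pullP, ha]
  · simp

lemma sum_histP_constAlg {n : ℕ} (t : ℕ) (Δ : ℝ) (i b : Fin n) :
    ∑ h : Fin t → Fin n × Bool, histP n (constAlg i) Δ b (hist h) = 1 := by
  simp_rw [histP_constAlg_hist]
  rw [← Fintype.sum_pow, sum_pullP, one_pow]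

lemma sum_sqrt_histP_constAlg_mul {n : ℕ} (t : ℕ) {Δ : ℝ} (h0 : 0 ≤ Δ) (h1 : Δ ≤ 1)
    {i j : Fin n} (hij : i ≠ j) :
    ∑ h : Fin t → Fin n × Bool,
        √(histP n (constAlg i) Δ i (hist h)) * √(histP n (constAlg i) Δ j (hist h)) =
      √(1 - Δ ^ 2) ^ t := by
  rw [← sum_sqrt_pullP_mul hij, Fintype.sum_pow]
  refine Finset.sum_congr rfl fun h _ => ?_
  rw [histP_constAlg_hist, histP_constAlg_hist,
    ← Real.sqrt_mul (Finset.prod_nonneg fun s _ => pullP_nonneg h0 h1 _ _ _),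
    ← Finset.prod_mul_distrib,
    Real.sqrt_prod _ fun s _ => mul_nonneg (pullP_nonneg h0 h1 _ _ _) (pullP_nonneg h0 h1 _ _ _)]

lemma le_mutualInfo_constAlg {n : ℕ} (t : ℕ) {Δ : ℝ} (h0 : 0 ≤ Δ) (h1 : Δ ≤ 1)
    {i j : Fin n} (hij : i ≠ j) :
    (1 - √(1 - Δ ^ 2) ^ t) / n ≤ mutualInfo n t (constAlg i) Δ := by
  have hexpand : ∑ h : Fin t → Fin n × Bool, (√(histP n (constAlg i) Δ i (hist h)) -
      √(histP n (constAlg i) Δ j (hist h))) ^ 2 = 2 * (1 - √(1 - Δ ^ 2) ^ t) := by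
    have hterm (h : Fin t → Fin n × Bool) : (√(histP n (constAlg i) Δ i (hist h)) -
        √(histP n (constAlg i) Δ j (hist h))) ^ 2 =
        histP n (constAlg i) Δ i (hist h) + histP n (constAlg i) Δ j (hist h) -
          2 * (√(histP n (constAlg i) Δ i (hist h)) *
            √(histP n (constAlg i) Δ j (hist h))) := by
      have hp b := (histP_mem_Icc (isAlg_constAlg i) h0 h1 b (hist h)).1
      rw [sub_sq, Real.sq_sqrt (hp i), Real.sq_sqrt (hp j)]
      ring
    simp_rw [hterm]
    rw [Finset.sum_sub_distrib, Finset.sum_add_distrib, ← Finset.mul_sum,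
      sum_histP_constAlg, sum_histP_constAlg, sum_sqrt_histP_constAlg_mul t h0 h1 hij]
    ring
  refine le_of_eq_of_le ?_ (hellinger_le_mutualInfo t (isAlg_constAlg i) h0 h1 hij)
  rw [hexpand, mul_inv]
  ring

lemma sqrt_one_sub_sq_pow_le {Δ : ℝ} (t : ℕ) (ht : t * Δ ^ 2 ≤ 1) :
    √(1 - Δ ^ 2) ^ t ≤ 1 - t * Δ ^ 2 / 4 := by
  have hbase : √(1 - Δ ^ 2) ≤ Real.exp (-(Δ ^ 2 / 2)) := by
    have h := Real.sqrt_le_sqrt (Real.one_sub_le_exp_neg (Δ ^ 2))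
    rwa [← Real.exp_half, neg_div] at h
  set x : ℝ := t * Δ ^ 2 / 2 with hx
  have hx0 : 0 ≤ x := by positivity
  calc √(1 - Δ ^ 2) ^ t ≤ Real.exp (-(Δ ^ 2 / 2)) ^ t :=
        pow_le_pow_left₀ (Real.sqrt_nonneg _) hbase t
    _ = (Real.exp x)⁻¹ := by
        rw [← Real.exp_nat_mul, ← Real.exp_neg, hx]
        congr 1
        ring
    _ ≤ (1 + x)⁻¹ := inv_anti₀ (by positivity) (by linarith [Real.add_one_le_exp x])
    _ ≤ 1 - x / 2 := by
        rw [inv_le_iff_one_le_mul₀ (by positivity)]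
        nlinarith
    _ = 1 - t * Δ ^ 2 / 4 := by rw [hx]; ring

/-- Achievability for the mutual information, first linear regime: for every `ε ∈ (0,1)` there
is `c > 0` such that for all `n ≥ 2`, `Δ ∈ (0, 1-ε]` and horizons `t ≤ 1/Δ²` with `t ≤ n/Δ²`,
`I*_t ≥ c t Δ² / n`. -/
theorem bandit_info_achievability_small_t :
    ∀ ε : ℝ, ε ∈ Set.Ioo (0 : ℝ) 1 → ∃ c : ℝ, 0 < c ∧
      ∀ n : ℕ, 2 ≤ n → ∀ Δ : ℝ, Δ ∈ Set.Ioc (0 : ℝ) (1 - ε) →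
        ∀ t : ℕ, (t : ℝ) ≤ 1 / Δ ^ 2 → (t : ℝ) ≤ (n : ℝ) / Δ ^ 2 →
          c * t * Δ ^ 2 / n ≤ IStar n t Δ := by
  intro ε hε
  refine ⟨1 / 4, by norm_num, fun n hn Δ hΔ t ht _ => ?_⟩
  have h0 : 0 ≤ Δ := hΔ.1.le
  have h1 : Δ ≤ 1 := by linarith [hΔ.2, hε.1]
  have ht' : t * Δ ^ 2 ≤ 1 := (le_div_iff₀ (pow_pos hΔ.1 2)).1 ht
  have hij : (⟨0, by lia⟩ : Fin n) ≠ ⟨1, by lia⟩ := by simp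
  refine le_trans ?_ ((le_mutualInfo_constAlg t h0 h1 hij).trans
    (mutualInfo_le_IStar t (by lia) (isAlg_constAlg _) h0 h1))
  refine div_le_div_of_nonneg_right ?_ n.cast_nonneg
  linarith [sqrt_one_sub_sq_pow_le t ht']
end
end
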